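/- arXiv:0801.1873 — 2 statements merged into one kernel-verified Lean document; each statement's English description precedes it below -/
import Mathlib

section
/- For every 2 ≤ p < ∞ there is a constant c(p), depending only on p (in particular independent of m, μ and L), with the following property. In the finite reversible Markov semigroup setup, assume the Bakry–Émery condition Γ² ≥ 0, and let S be a real m×m matrix with S·S = L that is self-adjoint and positive semidefinite with respect to ⟨·,·⟩_μ (i.e. ⟨S f, g⟩_μ = ⟨f, S g⟩_μ and ⟨f, S f⟩_μ ≥ 0 for all f, g). Then for every f : Fin m → ℝ one has ‖S f‖_{p,μ} ≤ c(p) · ‖(Γ(f,f))^{1/2}‖_{p,μ}, where (Γ(f,f))^{1/2} denotes the pointwise square root (Γ(f,f) is pointwise nonnegative under the standing hypotheses). (This is the commutative, finite-state instance of the paper's main Riesz-transform estimate ‖A^{1/2}x‖_p ≤ c(p)·max{‖Γ(x,x)^{1/2}‖_p, ‖Γ(x*,x*)^{1/2}‖_p}.) -/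
open scoped BigOperators

/-- Weighted `L_p` norm on `Fin m` with weights `μ`. -/
noncomputable def lpNormMu {m : ℕ} (μ : Fin m → ℝ) (p : ℝ) (g : Fin m → ℝ) : ℝ :=
  (∑ i, μ i * |g i| ^ p) ^ (1 / p)

/-- Weighted inner product `⟨f,g⟩_μ = Σ_i μ i · f i · g i`. -/
noncomputable def innerMu {m : ℕ} (μ : Fin m → ℝ) (f g : Fin m → ℝ) : ℝ :=
  ∑ i, μ i * f i * g i

/-- Gradient form `Γ(f,g)(i) = ½(f·(Lg) + g·(Lf) − L(f·g))(i)`. -/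
noncomputable def gradForm {m : ℕ} (L : Matrix (Fin m) (Fin m) ℝ) (f g : Fin m → ℝ) :
    Fin m → ℝ :=
  fun i => (f i * L.mulVec g i + g i * L.mulVec f i - L.mulVec (fun j => f j * g j) i) / 2

/-- Iterated gradient form `Γ₂(f,f) = Γ(Lf,f) − ½·L(Γ(f,f))`. -/
noncomputable def gradForm2 {m : ℕ} (L : Matrix (Fin m) (Fin m) ℝ) (f : Fin m → ℝ) :
    Fin m → ℝ :=
  fun i => gradForm L (L.mulVec f) f i - L.mulVec (gradForm L f f) i / 2

/-- A function with nonpositive derivative on `[0, ∞)` is bounded by its initial value. -/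
lemma le_initial_of_deriv_nonpos {g g₁ : ℝ → ℝ}
    (h₁ : ∀ t, 0 ≤ t → HasDerivAt g (g₁ t) t) (hg₁ : ∀ t, 0 ≤ t → g₁ t ≤ 0) {t : ℝ}
    (ht : 0 ≤ t) : g t ≤ g 0 := by
  have hanti : AntitoneOn g (Set.Ici 0) := by
    refine antitoneOn_of_deriv_nonpos (convex_Ici 0)
      (fun x hx => (h₁ x hx).continuousAt.continuousWithinAt) ?_ ?_
    · intro x hx
      rw [interior_Ici] at hx
      exact (h₁ x (le_of_lt hx)).differentiableAt.differentiableWithinAt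
    · intro x hx
      rw [interior_Ici] at hx
      rw [(h₁ x (le_of_lt hx)).deriv]
      exact hg₁ x (le_of_lt hx)
  exact hanti Set.self_mem_Ici ht ht

/-- A function on `[0, ∞)` that is convex and bounded above is bounded by its initial value. -/
lemma le_initial_of_deriv2_nonneg_of_bddAbove {g g₁ g₂ : ℝ → ℝ} {C : ℝ}
    (h₁ : ∀ t, 0 ≤ t → HasDerivAt g (g₁ t) t) (h₂ : ∀ t, 0 ≤ t → HasDerivAt g₁ (g₂ t) t)
    (hg₂ : ∀ t, 0 ≤ t → 0 ≤ g₂ t) (hC : ∀ t, 0 ≤ t → g t ≤ C) {t : ℝ} (ht : 0 ≤ t) :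
    g t ≤ g 0 := by
  have hmono : MonotoneOn g₁ (Set.Ici 0) := by
    refine monotoneOn_of_deriv_nonneg (convex_Ici 0)
      (fun x hx => (h₂ x hx).continuousAt.continuousWithinAt) ?_ ?_
    · intro x hx
      rw [interior_Ici] at hx
      exact (h₂ x (le_of_lt hx)).differentiableAt.differentiableWithinAt
    · intro x hx
      rw [interior_Ici] at hx
      rw [(h₂ x (le_of_lt hx)).deriv]
      exact hg₂ x (le_of_lt hx)
  have hneg : ∀ a, 0 ≤ a → g₁ a ≤ 0 := by
    intro a ha
    by_contra! hpos
    have hgrow : ∀ x, a ≤ x → g₁ a * (x - a) ≤ g x - g a := by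
      intro x hx
      refine (convex_Ici a).mul_sub_le_image_sub_of_le_deriv
        (fun y hy => (h₁ y (ha.trans hy)).continuousAt.continuousWithinAt) ?_ ?_ a
        Set.self_mem_Ici x hx hx
      · intro y hy
        rw [interior_Ici] at hy
        exact (h₁ y (ha.trans (le_of_lt hy))).differentiableAt.differentiableWithinAt
      · intro y hy
        rw [interior_Ici] at hy
        have hy' : a ≤ y := le_of_lt hy
        rw [(h₁ y (ha.trans hy')).deriv]
        exact hmono ha (ha.trans hy') hy'
    have hCa : 0 < C - g a + 1 := by linarith [hC a ha]
    have hx : a ≤ a + (C - g a + 1) / g₁ a := by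
      have := div_pos hCa hpos
      linarith
    have h3 := hgrow _ hx
    have h4 := hC _ (ha.trans hx)
    have h5 : g₁ a * (a + (C - g a + 1) / g₁ a - a) = C - g a + 1 := by
      field_simp
      ring
    linarith
  exact le_initial_of_deriv_nonpos h₁ hneg ht

lemma rpow_tangent_le {r x y : ℝ} (hr : 1 ≤ r) (hx : 0 < x) (hy : 0 < y) :
    x ^ r + r * x ^ (r - 1) * (y - x) ≤ y ^ r := by
  have hb := one_add_mul_self_le_rpow_one_add (s := y / x - 1) (p := r)
    (by have := div_pos hy hx; linarith) hr
  have hxr : 0 < x ^ r := Real.rpow_pos_of_pos hx r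
  have e1 : (1 + (y / x - 1)) ^ r = y ^ r / x ^ r := by
    rw [add_sub_cancel, Real.div_rpow hy.le hx.le]
  rw [e1, le_div_iff₀ hxr] at hb
  have e2 : x ^ (r - 1) = x ^ r / x := Real.rpow_sub_one hx.ne' r
  rw [e2]
  calc _ = (1 + r * (y / x - 1)) * x ^ r := by field_simp
    _ ≤ _ := hb

lemma rpow_le_tangent {r x y : ℝ} (hr₀ : 0 ≤ r) (hr : r ≤ 1) (hx : 0 < x) (hy : 0 < y) :
    y ^ r ≤ x ^ r + r * x ^ (r - 1) * (y - x) := by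
  have hb := rpow_one_add_le_one_add_mul_self (s := y / x - 1) (p := r)
    (by have := div_pos hy hx; linarith) hr₀ hr
  have hxr : 0 < x ^ r := Real.rpow_pos_of_pos hx r
  have e1 : (1 + (y / x - 1)) ^ r = y ^ r / x ^ r := by
    rw [add_sub_cancel, Real.div_rpow hy.le hx.le]
  rw [e1, div_le_iff₀ hxr] at hb
  have e2 : x ^ (r - 1) = x ^ r / x := Real.rpow_sub_one hx.ne' r
  rw [e2]
  calc _ ≤ (1 + r * (y / x - 1)) * x ^ r := hb
    _ = _ := by field_simp

/-- Quantitative strict convexity of `x ↦ x ^ q` on `(0, M]` for `1 < q ≤ 2`. -/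
lemma rpow_taylor_lower {q a b M : ℝ} (hq : 1 < q) (hq2 : q ≤ 2) (ha : 0 < a) (hb : 0 < b)
    (haM : a ≤ M) (hbM : b ≤ M) :
    a ^ q + q * a ^ (q - 1) * (b - a) + q * (q - 1) / 2 * ((b - a) ^ 2 * M ^ (q - 2)) ≤ b ^ q := by
  set k := q * (q - 1) / 2 * M ^ (q - 2) with hk
  have hM : 0 < M := ha.trans_le haM
  have d1 : ∀ x, 0 < x → HasDerivAt (fun x : ℝ => x ^ q - k * (x - a) ^ 2)
      (q * x ^ (q - 1) - k * (2 * (x - a))) x := by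
    intro x hx
    have h1 := Real.hasDerivAt_rpow_const (x := x) (p := q) (Or.inl hx.ne')
    have h2 := (((hasDerivAt_id x).sub_const a).pow 2).const_mul k
    refine (h1.sub h2).congr_deriv ?_
    simp
  have d2 : ∀ x, 0 < x → HasDerivAt (fun x : ℝ => q * x ^ (q - 1) - k * (2 * (x - a)))
      (q * ((q - 1) * x ^ (q - 2)) - k * 2) x := by
    intro x hx
    have h1 := (Real.hasDerivAt_rpow_const (x := x) (p := q - 1) (Or.inl hx.ne')).const_mul q
    have h2 := ((((hasDerivAt_id x).sub_const a)).const_mul 2).const_mul k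
    refine (h1.sub h2).congr_deriv ?_
    rw [show q - 1 - 1 = q - 2 by ring]
    simp
  have hconv : ConvexOn ℝ (Set.Ioc 0 M) (fun x : ℝ => x ^ q - k * (x - a) ^ 2) := by
    refine convexOn_of_hasDerivWithinAt2_nonneg (convex_Ioc 0 M)
      (fun x hx => (d1 x hx.1).continuousAt.continuousWithinAt)
      (f' := fun x => q * x ^ (q - 1) - k * (2 * (x - a)))
      (f'' := fun x => q * ((q - 1) * x ^ (q - 2)) - k * 2) ?_ ?_ ?_
    · intro x hx
      exact (d1 x (interior_subset hx).1).hasDerivWithinAt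
    · intro x hx
      exact (d2 x (interior_subset hx).1).hasDerivWithinAt
    · intro x hx
      have hx' := interior_subset hx
      have h1 : M ^ (q - 2) ≤ x ^ (q - 2) :=
        Real.rpow_le_rpow_of_nonpos hx'.1 hx'.2 (by linarith)
      have h2 : 0 ≤ q * (q - 1) := by nlinarith
      have := mul_le_mul_of_nonneg_left h1 h2
      rw [hk]
      linarith
  have ht := d1 a ha
  have key : a ^ q - k * (a - a) ^ 2 + (q * a ^ (q - 1) - k * (2 * (a - a))) * (b - a)
      ≤ b ^ q - k * (b - a) ^ 2 := by
    rcases lt_trichotomy a b with h | h | h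
    · have := hconv.le_slope_of_hasDerivAt ⟨ha, haM⟩ ⟨hb, hbM⟩ h ht
      rw [slope_def_field, le_div_iff₀ (by linarith)] at this
      linarith
    · subst h; simp
    · have := hconv.slope_le_of_hasDerivAt ⟨hb, hbM⟩ ⟨ha, haM⟩ h ht
      rw [slope_def_field, div_le_iff₀ (by linarith)] at this
      linarith
  rw [hk] at key
  ring_nf at key ⊢
  linarith

lemma rpow_tangent_gap_le {q δ a b : ℝ} (hq : 1 < q) (hδ : 0 < δ) (hδ1 : δ ≤ 1)
    (ha : 0 < a) (hb : 0 < b) :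
    a ^ (q - δ) * (a ^ δ + δ * a ^ (δ - 1) * (b - a) - b ^ δ)
      ≤ 4 * ((b - a) ^ 2 * (max a b) ^ (q - 2)) := by
  have main : ∀ x : ℝ, 0 < x → 1 + δ * (x - 1) - x ^ δ ≤ 4 * ((x - 1) ^ 2 * (max 1 x) ^ (q - 2)) := by
    intro x hx
    have hlog : 1 + δ * (1 - x⁻¹) ≤ x ^ δ := by
      rw [Real.rpow_def_of_pos hx]
      have h1 := Real.add_one_le_exp (Real.log x * δ)
      have h2 := Real.one_sub_inv_le_log_of_pos hx
      nlinarith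
    have h3 : 1 + δ * (x - 1) - x ^ δ ≤ (x - 1) ^ 2 * x⁻¹ := by
      have e : x - 1 - (1 - x⁻¹) = (x - 1) ^ 2 * x⁻¹ := by field_simp
      have : 0 ≤ (x - 1) ^ 2 * x⁻¹ := by positivity
      nlinarith
    rcases le_total 1 x with h | h
    · rw [max_eq_right h]
      have h4 : x⁻¹ ≤ x ^ (q - 2) := by
        rw [← Real.rpow_neg_one]
        exact Real.rpow_le_rpow_of_exponent_le h (by linarith)
      have h5 := mul_le_mul_of_nonneg_left h4 (sq_nonneg (x - 1))
      have h6 : 0 ≤ (x - 1) ^ 2 * x ^ (q - 2) := by positivity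
      linarith
    · rw [max_eq_left h, Real.one_rpow, mul_one]
      rcases le_total (1 / 2) x with h' | h'
      · have h4 : x⁻¹ ≤ 2 := by
          rw [inv_le_comm₀ hx two_pos]; linarith
        have h5 := mul_le_mul_of_nonneg_left h4 (sq_nonneg (x - 1))
        nlinarith [sq_nonneg (x - 1)]
      · have : 0 < x ^ δ := Real.rpow_pos_of_pos hx δ
        nlinarith
  have hx := main (b / a) (div_pos hb ha)
  have haq : 0 < a ^ q := Real.rpow_pos_of_pos ha q
  have haδ : 0 < a ^ δ := Real.rpow_pos_of_pos ha δ
  have e1 : a ^ (q - δ) = a ^ q / a ^ δ := Real.rpow_sub ha q δ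
  have e2 : a ^ (δ - 1) = a ^ δ / a := Real.rpow_sub_one ha.ne' δ
  have e3 : max a b = a * max 1 (b / a) := by
    rw [mul_max_of_nonneg _ _ ha.le, mul_one, mul_div_cancel₀ _ ha.ne']
  have e4 : (max a b) ^ (q - 2) = a ^ q / a ^ 2 * (max 1 (b / a)) ^ (q - 2) := by
    rw [e3, Real.mul_rpow ha.le (by positivity), Real.rpow_sub ha, Real.rpow_two]
  have e5 : (b / a) ^ δ = b ^ δ / a ^ δ := Real.div_rpow hb.le ha.le δ
  rw [e5] at hx
  rw [e1, e2, e4]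
  have hx' := mul_le_mul_of_nonneg_left hx haq.le
  calc _ = a ^ q * (1 + δ * (b / a - 1) - b ^ δ / a ^ δ) := by field_simp
    _ ≤ _ := hx'
    _ = _ := by field_simp

/-- The Bellman function `(a, w) ↦ (w + a ^ δ) ^ r + A a ^ q` lies above its tangent plane, with a
quantitative gain in `a`. -/
lemma bellman_tangent_le {q δ r A a b w w' : ℝ} (hq : 1 < q) (hq2 : q ≤ 2) (hr : 1 ≤ r)
    (hδ : 0 < δ) (hδr : δ * r = q) (hA : A * (q * (q - 1)) = 1 + 8 * (r * 2 ^ (r - 1)))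
    (ha : 0 < a) (hb : 0 < b) (hw : 0 ≤ w) (hw' : 0 ≤ w') (hδw : 1 ≤ δ ∨ w ≤ a ^ δ) :
    (w + a ^ δ) ^ r + A * a ^ q + r * (w + a ^ δ) ^ (r - 1) * (w' - w + δ * a ^ (δ - 1) * (b - a))
        + A * (q * a ^ (q - 1) * (b - a)) + (b - a) ^ 2 * (max a b) ^ (q - 2) / 2
      ≤ (w' + b ^ δ) ^ r + A * b ^ q := by
  set X := (b - a) ^ 2 * (max a b) ^ (q - 2) with hX
  have hX0 : 0 ≤ X := by positivity
  have haδ : 0 < a ^ δ := Real.rpow_pos_of_pos ha δ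
  have hbδ : 0 < b ^ δ := Real.rpow_pos_of_pos hb δ
  have h1 := rpow_tangent_le hr (x := w + a ^ δ) (y := w' + b ^ δ) (by linarith) (by linarith)
  have h2 := rpow_taylor_lower hq hq2 ha hb (le_max_left a b) (le_max_right a b)
  rw [← hX] at h2
  have hA0 : 0 < A := by
    have : 0 < q * (q - 1) := by nlinarith
    have h : 0 < A * (q * (q - 1)) := by rw [hA]; positivity
    exact pos_of_mul_pos_left h this.le
  have h2' := mul_le_mul_of_nonneg_left h2 hA0.le
  have hs0 : 0 ≤ r * (w + a ^ δ) ^ (r - 1) := by positivity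
  have h3 : r * (w + a ^ δ) ^ (r - 1) * (a ^ δ + δ * a ^ (δ - 1) * (b - a) - b ^ δ)
      ≤ 4 * (r * 2 ^ (r - 1)) * X := by
    by_cases hδ1 : 1 ≤ δ
    · have h4 := rpow_tangent_le hδ1 ha hb
      have h5 : 0 ≤ 4 * (r * 2 ^ (r - 1)) * X := by positivity
      nlinarith
    · have hwa : w ≤ a ^ δ := hδw.resolve_left hδ1
      push Not at hδ1
      have h4 := rpow_le_tangent hδ.le hδ1.le ha hb
      have h5 : (w + a ^ δ) ^ (r - 1) ≤ 2 ^ (r - 1) * a ^ (q - δ) := by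
        rw [show q - δ = δ * (r - 1) by rw [← hδr]; ring, Real.rpow_mul ha.le,
          ← Real.mul_rpow two_pos.le haδ.le]
        exact Real.rpow_le_rpow (by positivity) (by linarith) (by linarith)
      have h6 := rpow_tangent_gap_le hq hδ hδ1.le ha hb
      rw [← hX] at h6
      calc _ ≤ r * (2 ^ (r - 1) * a ^ (q - δ)) * (a ^ δ + δ * a ^ (δ - 1) * (b - a) - b ^ δ) := by
            have : 0 ≤ a ^ δ + δ * a ^ (δ - 1) * (b - a) - b ^ δ := by linarith
            gcongr
        _ = r * 2 ^ (r - 1) * (a ^ (q - δ) * (a ^ δ + δ * a ^ (δ - 1) * (b - a) - b ^ δ)) := by ring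
        _ ≤ r * 2 ^ (r - 1) * (4 * X) := by gcongr
        _ = _ := by ring
  have h7 : A * (q * (q - 1) / 2 * X) = X / 2 + 4 * (r * 2 ^ (r - 1)) * X := by
    linear_combination X / 2 * hA
  nlinarith

/-- Nonnegativity of the Hessian of the Bellman function. -/
lemma bellman_hessian_nonneg {q δ r A a w x y : ℝ} (hq : 1 < q) (hr : 1 ≤ r)
    (hδ : 0 < δ) (hδr : δ * r = q) (hA : A * (q * (q - 1)) = 1 + 8 * (r * 2 ^ (r - 1)))
    (ha : 0 < a) (hw : 0 ≤ w) (hδw : 1 ≤ δ ∨ w ≤ a ^ δ) :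
    0 ≤ r * ((r - 1) * (w + a ^ δ) ^ (r - 2) * y ^ 2
        + (w + a ^ δ) ^ (r - 1) * (δ * (δ - 1) * a ^ (δ - 2) * x ^ 2))
      + A * (q * (q - 1)) * a ^ (q - 2) * x ^ 2 := by
  have haδ : 0 < a ^ δ := Real.rpow_pos_of_pos ha δ
  have h0 : 0 ≤ r * ((r - 1) * (w + a ^ δ) ^ (r - 2) * y ^ 2) := by
    have : 0 ≤ r - 1 := by linarith
    positivity
  have hP : 0 < r * 2 ^ (r - 1) := by positivity
  rw [hA]
  by_cases hδ1 : 1 ≤ δ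
  · have : 0 ≤ r * ((w + a ^ δ) ^ (r - 1) * (δ * (δ - 1) * a ^ (δ - 2) * x ^ 2)) := by
      have : 0 ≤ δ - 1 := by linarith
      positivity
    have : 0 ≤ (1 + 8 * (r * 2 ^ (r - 1))) * a ^ (q - 2) * x ^ 2 := by positivity
    linarith
  · have hwa : w ≤ a ^ δ := hδw.resolve_left hδ1
    push Not at hδ1
    have h5 : (w + a ^ δ) ^ (r - 1) ≤ 2 ^ (r - 1) * a ^ (q - δ) := by
      rw [show q - δ = δ * (r - 1) by rw [← hδr]; ring, Real.rpow_mul ha.le,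
        ← Real.mul_rpow two_pos.le haδ.le]
      exact Real.rpow_le_rpow (by positivity) (by linarith) (by linarith)
    have h6 : δ * (1 - δ) ≤ 1 := by nlinarith
    have h7 : 0 ≤ δ * (1 - δ) := by nlinarith
    have h8 : (w + a ^ δ) ^ (r - 1) * (δ * (1 - δ) * a ^ (δ - 2) * x ^ 2)
        ≤ 2 ^ (r - 1) * a ^ (q - δ) * (1 * a ^ (δ - 2) * x ^ 2) := by gcongr
    have h9 : a ^ (q - δ) * a ^ (δ - 2) = a ^ (q - 2) := by
      rw [← Real.rpow_add ha]; ring_nf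
    have h10 := mul_le_mul_of_nonneg_left h8 (by linarith : 0 ≤ r)
    have h11 : 0 ≤ a ^ (q - 2) * x ^ 2 := by positivity
    have h12 : r * (2 ^ (r - 1) * a ^ (q - δ) * (1 * a ^ (δ - 2) * x ^ 2))
        = r * 2 ^ (r - 1) * (a ^ (q - 2) * x ^ 2) := by rw [← h9]; ring
    rw [h12] at h10
    nlinarith

section Symmetric

variable {ι : Type*} [Fintype ι] {μ : ι → ℝ} {c : ι → ι → ℝ}

lemma sum_reversible_swap (hsymm : ∀ i j, μ i * c i j = μ j * c j i) (F : ι → ι → ℝ) :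
    ∑ i, ∑ j, μ i * c i j * F i j = ∑ i, ∑ j, μ i * c i j * F j i := by
  rw [Finset.sum_comm]
  refine Finset.sum_congr rfl fun i _ => Finset.sum_congr rfl fun j _ => ?_
  rw [hsymm]

lemma sum_reversible_sub_eq_zero (hsymm : ∀ i j, μ i * c i j = μ j * c j i) (F : ι → ℝ) :
    ∑ i, ∑ j, μ i * c i j * (F i - F j) = 0 := by
  have h := sum_reversible_swap hsymm fun i _ => F i
  simp only [mul_sub, Finset.sum_sub_distrib]
  linarith

/-- Discrete Green formula. -/
lemma sum_reversible_green (hsymm : ∀ i j, μ i * c i j = μ j * c j i) (f g : ι → ℝ) :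
    ∑ i, ∑ j, μ i * c i j * (f i * (g i - g j))
      = (∑ i, ∑ j, μ i * c i j * ((f i - f j) * (g i - g j))) / 2 := by
  have h := sum_reversible_swap hsymm fun i j => f i * (g i - g j)
  have e : ∑ i, ∑ j, μ i * c i j * ((f i - f j) * (g i - g j))
      = ∑ i, ∑ j, μ i * c i j * (f i * (g i - g j))
        + ∑ i, ∑ j, μ i * c i j * (f j * (g j - g i)) := by
    simp only [← Finset.sum_add_distrib]
    refine Finset.sum_congr rfl fun i _ => Finset.sum_congr rfl fun j _ => ?_
    ring
  linarith

/-- Minimum principle for bounded superharmonic functions on the half-space `[0, ∞) × ι`. -/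
lemma superharmonic_nonneg (hμ : ∀ i, 0 < μ i) (hμ1 : ∑ i, μ i = 1)
    (hc : ∀ i j, 0 ≤ c i j) (hsymm : ∀ i j, μ i * c i j = μ j * c j i)
    {g g₁ g₂ : ℝ → ι → ℝ} {C : ℝ}
    (h₁ : ∀ t, 0 ≤ t → ∀ i, HasDerivAt (fun s => g s i) (g₁ t i) t)
    (h₂ : ∀ t, 0 ≤ t → ∀ i, HasDerivAt (fun s => g₁ s i) (g₂ t i) t)
    (hg₂ : ∀ t, 0 ≤ t → ∀ i, g₂ t i ≤ ∑ j, c i j * (g t i - g t j))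
    (hC : ∀ t, 0 ≤ t → ∀ i, C ≤ g t i) (h₀ : ∀ i, 0 ≤ g 0 i) {t : ℝ} (ht : 0 ≤ t) (i : ι) :
    0 ≤ g t i := by
  have key : ∀ l : ℝ, 0 < l → ∑ i, μ i * Real.exp (-l * g t i) ≤ 1 := by
    intro l hl
    have e1 : ∀ t, 0 ≤ t → ∀ i, HasDerivAt (fun s => Real.exp (-l * g s i))
        (Real.exp (-l * g t i) * (-l * g₁ t i)) t :=
      fun t ht i => ((h₁ t ht i).const_mul (-l)).exp
    have e2 : ∀ t, 0 ≤ t → ∀ i, HasDerivAt (fun s => Real.exp (-l * g s i) * (-l * g₁ s i))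
        (Real.exp (-l * g t i) * ((l * g₁ t i) ^ 2 - l * g₂ t i)) t := by
      intro t ht i
      refine ((e1 t ht i).mul ((h₂ t ht i).const_mul (-l))).congr_deriv ?_
      ring
    have := le_initial_of_deriv2_nonneg_of_bddAbove
      (g := fun t => ∑ i, μ i * Real.exp (-l * g t i))
      (g₁ := fun t => ∑ i, μ i * (Real.exp (-l * g t i) * (-l * g₁ t i)))
      (g₂ := fun t => ∑ i, μ i * (Real.exp (-l * g t i) * ((l * g₁ t i) ^ 2 - l * g₂ t i)))
      (C := Real.exp (-l * C))
      (fun t ht => HasDerivAt.fun_sum fun i _ => (e1 t ht i).const_mul (μ i))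
      (fun t ht => HasDerivAt.fun_sum fun i _ => (e2 t ht i).const_mul (μ i)) ?_ ?_ ht
    · refine this.trans ?_
      rw [← hμ1]
      refine Finset.sum_le_sum fun i _ => ?_
      have : Real.exp (-l * g 0 i) ≤ 1 := Real.exp_le_one_iff.2 (by nlinarith [h₀ i])
      nlinarith [hμ i]
    · intro t ht
      rw [← sum_reversible_sub_eq_zero hsymm fun i => Real.exp (-l * g t i)]
      refine Finset.sum_le_sum fun i _ => ?_
      have hE := Real.exp_pos (-l * g t i)
      calc ∑ j, μ i * c i j * (Real.exp (-l * g t i) - Real.exp (-l * g t j))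
          ≤ ∑ j, μ i * c i j * (Real.exp (-l * g t i) * (-l * (g t i - g t j))) := by
            refine Finset.sum_le_sum fun j _ => ?_
            refine mul_le_mul_of_nonneg_left ?_ (mul_nonneg (hμ i).le (hc i j))
            have h3 := Real.add_one_le_exp (-l * g t j - -l * g t i)
            have h4 : Real.exp (-l * g t j)
                = Real.exp (-l * g t i) * Real.exp (-l * g t j - -l * g t i) := by
              rw [← Real.exp_add]; ring_nf
            rw [h4]
            nlinarith
        _ = μ i * (Real.exp (-l * g t i) * (-l * ∑ j, c i j * (g t i - g t j))) := by
            simp only [Finset.mul_sum]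
            refine Finset.sum_congr rfl fun j _ => ?_
            ring
        _ ≤ _ := by
            refine mul_le_mul_of_nonneg_left (mul_le_mul_of_nonneg_left ?_ hE.le) (hμ i).le
            nlinarith [hg₂ t ht i, sq_nonneg (l * g₁ t i)]
    · intro t ht
      calc ∑ i, μ i * Real.exp (-l * g t i) ≤ ∑ i, μ i * Real.exp (-l * C) := by
            refine Finset.sum_le_sum fun i _ => ?_
            refine mul_le_mul_of_nonneg_left (Real.exp_le_exp.2 ?_) (hμ i).le
            nlinarith [hC t ht i]
        _ = _ := by rw [← Finset.sum_mul, hμ1, one_mul]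
  by_contra! hneg
  have hl : 0 < (μ i)⁻¹ / -g t i := div_pos (inv_pos.2 (hμ i)) (by linarith)
  have h2 := (Finset.single_le_sum (fun j _ => mul_nonneg (hμ j).le (Real.exp_pos _).le)
    (Finset.mem_univ i)).trans (key _ hl)
  have h3 : -((μ i)⁻¹ / -g t i) * g t i = (μ i)⁻¹ := by
    have := hneg.ne
    field_simp
  rw [h3] at h2
  have h4 := mul_le_mul_of_nonneg_left (Real.add_one_le_exp (μ i)⁻¹) (hμ i).le
  have h5 : μ i * ((μ i)⁻¹ + 1) = 1 + μ i := by rw [mul_add, mul_inv_cancel₀ (hμ i).ne', mul_one]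
  linarith [hμ i]

/-- The second-order differential inequality for the Bellman function, integrated over `ι`. -/
lemma bellman_sum_lower {q δ r A : ℝ} (hq : 1 < q) (hq2 : q ≤ 2) (hr : 1 ≤ r)
    (hδ : 0 < δ) (hδr : δ * r = q) (hδq : q - δ = 2 - q)
    (hA : A * (q * (q - 1)) = 1 + 8 * (r * 2 ^ (r - 1)))
    (hμ : ∀ i, 0 < μ i) (hc : ∀ i j, 0 ≤ c i j) (hsymm : ∀ i j, μ i * c i j = μ j * c j i)
    {k k₁ k₂ w w₁ w₂ v : ι → ℝ} (hk : ∀ i, 0 < k i) (hw : ∀ i, 0 ≤ w i)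
    (hδw : 1 ≤ δ ∨ ∀ i, w i ≤ k i ^ δ)
    (hk₂ : ∀ i, k₂ i = ∑ j, c i j * (k i - k j))
    (hw₂ : ∀ i, ∑ j, c i j * (v i - v j) ^ 2 + ∑ j, c i j * (w i - w j) ≤ w₂ i) :
    ∑ i, ∑ j, μ i * c i j * (|v i - v j| * |k i - k j|)
      ≤ ∑ i, μ i * (r * ((r - 1) * (w i + k i ^ δ) ^ (r - 2) * (w₁ i + δ * k i ^ (δ - 1) * k₁ i) ^ 2
          + (w i + k i ^ δ) ^ (r - 1) * (w₂ i + δ * ((δ - 1) * k i ^ (δ - 2) * k₁ i ^ 2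
            + k i ^ (δ - 1) * k₂ i)))
        + A * (q * ((q - 1) * k i ^ (q - 2) * k₁ i ^ 2 + k i ^ (q - 1) * k₂ i))) := by
  have hδw' : ∀ i, 1 ≤ δ ∨ w i ≤ k i ^ δ := fun i => hδw.imp id fun h => h i
  set B : ι → ℝ := fun i => (w i + k i ^ δ) ^ r + A * k i ^ q with hB
  have hpoint : ∀ i, ∑ j, μ i * c i j * (k i ^ (2 - q) * (v i - v j) ^ 2
        + (k j - k i) ^ 2 * (max (k i) (k j)) ^ (q - 2) / 2 + (B i - B j))
      ≤ μ i * (r * ((r - 1) * (w i + k i ^ δ) ^ (r - 2) * (w₁ i + δ * k i ^ (δ - 1) * k₁ i) ^ 2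
          + (w i + k i ^ δ) ^ (r - 1) * (w₂ i + δ * ((δ - 1) * k i ^ (δ - 2) * k₁ i ^ 2
            + k i ^ (δ - 1) * k₂ i)))
        + A * (q * ((q - 1) * k i ^ (q - 2) * k₁ i ^ 2 + k i ^ (q - 1) * k₂ i))) := by
    intro i
    have hki := hk i
    have hkδ : 0 < k i ^ δ := Real.rpow_pos_of_pos hki δ
    have hH := bellman_hessian_nonneg (x := k₁ i) (y := w₁ i + δ * k i ^ (δ - 1) * k₁ i)
      hq hr hδ hδr hA hki (hw i) (hδw' i)
    set P := r * (w i + k i ^ δ) ^ (r - 1) with hP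
    have hP1 : k i ^ (2 - q) ≤ P := by
      rw [← hδq, show q - δ = δ * (r - 1) by rw [← hδr]; ring, Real.rpow_mul hki.le]
      calc (k i ^ δ) ^ (r - 1) ≤ (w i + k i ^ δ) ^ (r - 1) :=
            Real.rpow_le_rpow hkδ.le (by linarith [hw i]) (by linarith)
        _ ≤ P := le_mul_of_one_le_left (by have := hw i; positivity) hr
    have hP0 : 0 ≤ P := (Real.rpow_nonneg hki.le _).trans hP1
    have hpair : ∀ j, μ i * c i j * (k i ^ (2 - q) * (v i - v j) ^ 2
        + (k j - k i) ^ 2 * (max (k i) (k j)) ^ (q - 2) / 2 + (B i - B j))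
        ≤ μ i * (P * (c i j * (v i - v j) ^ 2) + P * (c i j * (w i - w j))
          + (P * (δ * k i ^ (δ - 1)) + A * (q * k i ^ (q - 1))) * (c i j * (k i - k j))) := by
      intro j
      have h1 := bellman_tangent_le hq hq2 hr hδ hδr hA hki (hk j) (hw i) (hw j) (hδw' i)
      have h2 := mul_le_mul_of_nonneg_right hP1 (sq_nonneg (v i - v j))
      rw [← hP] at h1
      have h3 : k i ^ (2 - q) * (v i - v j) ^ 2
          + (k j - k i) ^ 2 * (max (k i) (k j)) ^ (q - 2) / 2 + (B i - B j)
          ≤ P * (v i - v j) ^ 2 + P * (w i - w j)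
            + (P * (δ * k i ^ (δ - 1)) + A * (q * k i ^ (q - 1))) * (k i - k j) := by
        simp only [hB]
        nlinarith
      calc _ ≤ _ := mul_le_mul_of_nonneg_left h3 (mul_nonneg (hμ i).le (hc i j))
        _ = _ := by ring
    refine (Finset.sum_le_sum fun j _ => hpair j).trans ?_
    rw [← Finset.mul_sum]
    refine mul_le_mul_of_nonneg_left ?_ (hμ i).le
    simp only [Finset.sum_add_distrib, ← Finset.mul_sum]
    rw [← hk₂ i]
    have h4 := mul_le_mul_of_nonneg_left (hw₂ i) hP0
    rw [hP] at h4 ⊢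
    nlinarith
  refine le_trans ?_ (Finset.sum_le_sum fun i _ => hpoint i)
  have hsplit : ∑ i, ∑ j, μ i * c i j * (k i ^ (2 - q) * (v i - v j) ^ 2
        + (k j - k i) ^ 2 * (max (k i) (k j)) ^ (q - 2) / 2 + (B i - B j))
      = ∑ i, ∑ j, μ i * c i j * ((k i ^ (2 - q) + k j ^ (2 - q)) * (v i - v j) ^ 2 / 2
        + (k j - k i) ^ 2 * (max (k i) (k j)) ^ (q - 2) / 2) := by
    have h1 := sum_reversible_sub_eq_zero hsymm B
    have h2 := sum_reversible_swap hsymm fun i j => k i ^ (2 - q) * (v i - v j) ^ 2 / 2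
    have h3 : ∀ i j, k j ^ (2 - q) * (v j - v i) ^ 2 / 2 = k j ^ (2 - q) * (v i - v j) ^ 2 / 2 :=
      fun i j => by ring
    simp only [h3] at h2
    rw [← add_zero (∑ i, ∑ j, μ i * c i j * ((k i ^ (2 - q) + k j ^ (2 - q)) * _ / 2 + _)), ← h1,
      ← add_zero (_ + _), ← sub_eq_zero.2 h2]
    simp only [← Finset.sum_add_distrib, ← Finset.sum_sub_distrib]
    refine Finset.sum_congr rfl fun i _ => Finset.sum_congr rfl fun j _ => ?_
    ring
  rw [hsplit]
  refine Finset.sum_le_sum fun i _ => Finset.sum_le_sum fun j _ => ?_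
  refine mul_le_mul_of_nonneg_left ?_ (mul_nonneg (hμ i).le (hc i j))
  set M := max (k i) (k j) with hM
  have hM0 : 0 < M := lt_max_of_lt_left (hk i)
  have h1 : M ^ (2 - q) ≤ k i ^ (2 - q) + k j ^ (2 - q) := by
    have hi := Real.rpow_nonneg (hk i).le (2 - q)
    have hj := Real.rpow_nonneg (hk j).le (2 - q)
    rcases max_choice (k i) (k j) with h | h <;> rw [hM, h] <;> linarith
  have h2 : M ^ (2 - q) * M ^ (q - 2) = 1 := by
    rw [← Real.rpow_add hM0]; simp
  have h3 : 0 < M ^ (2 - q) := Real.rpow_pos_of_pos hM0 _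
  have h4 : 0 < M ^ (q - 2) := Real.rpow_pos_of_pos hM0 _
  have h5 := mul_le_mul_of_nonneg_right h1 (sq_nonneg (v i - v j))
  rw [abs_sub_comm (k i), ← sq_abs (v i - v j), ← sq_abs (k j - k i)] at *
  set x := |v i - v j|
  set y := |k j - k i|
  have h6 : 0 ≤ M ^ (q - 2) * (M ^ (2 - q) * x - y) ^ 2 := by positivity
  have h7 : M ^ (q - 2) * (M ^ (2 - q) * x - y) ^ 2
      = M ^ (2 - q) * x ^ 2 - 2 * (x * y) + M ^ (q - 2) * y ^ 2 := by
    linear_combination (M ^ (2 - q) * x ^ 2 - 2 * x * y) * h2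
  linarith

end Symmetric

section Flow

variable {m : ℕ} {μ : Fin m → ℝ} {L S : Matrix (Fin m) (Fin m) ℝ}

lemma mulVec_eq_sum_sub (hL : ∀ i, ∑ j, L i j = 0) (g : Fin m → ℝ) (i : Fin m) :
    L.mulVec g i = ∑ j, (if i = j then 0 else -L i j) * (g i - g j) := by
  have h1 : ∑ j, (if i = j then 0 else -L i j) * (g i - g j) = ∑ j, -L i j * (g i - g j) := by
    refine Finset.sum_congr rfl fun j _ => ?_
    by_cases h : i = j
    · subst h; simp
    · simp [h]
  have h2 : ∑ j, L i j * g i = 0 := by rw [← Finset.sum_mul, hL, zero_mul]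
  rw [h1]
  simp only [Matrix.mulVec, dotProduct]
  rw [← sub_zero (∑ j, L i j * g j), ← h2, ← Finset.sum_sub_distrib]
  exact Finset.sum_congr rfl fun j _ => by ring

lemma gradForm_eq_sum {c : Fin m → Fin m → ℝ}
    (hc : ∀ g i, L.mulVec g i = ∑ j, c i j * (g i - g j)) (f g : Fin m → ℝ) (i : Fin m) :
    gradForm L f g i = (∑ j, c i j * ((f i - f j) * (g i - g j))) / 2 := by
  simp only [gradForm, hc, Finset.mul_sum]
  rw [← Finset.sum_add_distrib, ← Finset.sum_sub_distrib]
  congr 1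
  exact Finset.sum_congr rfl fun j _ => by ring

lemma exists_hasDerivAt_neg_mulVec (S : Matrix (Fin m) (Fin m) ℝ) (f : Fin m → ℝ) :
    ∃ u : ℝ → Fin m → ℝ, u 0 = f ∧
      ∀ t i, HasDerivAt (fun s => u s i) (-S.mulVec (u t) i) t := by
  let T : (Fin m → ℝ) →L[ℝ] (Fin m → ℝ) := LinearMap.toContinuousLinearMap (-S).mulVecLin
  refine ⟨fun t => NormedSpace.exp (t • T) f, by simp, fun t i => ?_⟩
  have h := (hasDerivAt_exp_smul_const' T t).clm_apply (hasDerivAt_const t f)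
  refine (hasDerivAt_pi.1 h i).congr_deriv ?_
  simp [T]

lemma hasDerivAt_mulVec {u : ℝ → Fin m → ℝ} {u' : Fin m → ℝ} {t : ℝ}
    (S : Matrix (Fin m) (Fin m) ℝ) (h : ∀ i, HasDerivAt (fun s => u s i) (u' i) t) (i : Fin m) :
    HasDerivAt (fun s => S.mulVec (u s) i) (S.mulVec u' i) t := by
  simp only [Matrix.mulVec, dotProduct]
  exact HasDerivAt.fun_sum fun j _ => (h j).const_mul (S i j)

lemma hasDerivAt_innerMu {u v : ℝ → Fin m → ℝ} {u' v' : Fin m → ℝ} {t : ℝ}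
    (hu : ∀ i, HasDerivAt (fun s => u s i) (u' i) t)
    (hv : ∀ i, HasDerivAt (fun s => v s i) (v' i) t) :
    HasDerivAt (fun s => innerMu μ (u s) (v s)) (innerMu μ u' (v t) + innerMu μ (u t) v') t := by
  unfold innerMu
  rw [← Finset.sum_add_distrib]
  refine HasDerivAt.fun_sum fun i _ => ?_
  exact ((hu i).const_mul (μ i)).mul (hv i)

lemma innerMu_neg_left (f g : Fin m → ℝ) : innerMu μ (fun i => -f i) g = -innerMu μ f g := by
  simp [innerMu]

lemma innerMu_neg_right (f g : Fin m → ℝ) : innerMu μ f (fun i => -g i) = -innerMu μ f g := by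
  simp [innerMu]

lemma innerMu_comm (f g : Fin m → ℝ) : innerMu μ f g = innerMu μ g f := by
  unfold innerMu
  exact Finset.sum_congr rfl fun i _ => by ring

lemma flow_bounded (hμ : ∀ i, 0 < μ i) (hS : ∀ f, 0 ≤ innerMu μ f (S.mulVec f))
    {u : ℝ → Fin m → ℝ} (hu : ∀ t i, HasDerivAt (fun s => u s i) (-S.mulVec (u t) i) t) :
    ∃ K, ∀ t, 0 ≤ t → ∀ i, |u t i| ≤ K := by
  refine ⟨∑ i, (1 + innerMu μ (u 0) (u 0) / μ i), fun t ht i => ?_⟩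
  have h0 : ∀ f : Fin m → ℝ, 0 ≤ innerMu μ f f := fun f =>
    Finset.sum_nonneg fun i _ => by
      rw [mul_assoc]; exact mul_nonneg (hμ i).le (mul_self_nonneg _)
  have h1 : innerMu μ (u t) (u t) ≤ innerMu μ (u 0) (u 0) := by
    refine le_initial_of_deriv_nonpos (g := fun t => innerMu μ (u t) (u t))
      (fun t _ => hasDerivAt_innerMu (hu t) (hu t)) (fun t _ => ?_) ht
    rw [innerMu_neg_left, innerMu_neg_right, innerMu_comm]
    linarith [hS (u t)]
  have h2 : μ i * u t i * u t i ≤ innerMu μ (u t) (u t) :=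
    Finset.single_le_sum (f := fun i => μ i * u t i * u t i) (fun j _ => by
      rw [mul_assoc]; exact mul_nonneg (hμ j).le (mul_self_nonneg _)) (Finset.mem_univ i)
  have h3 : u t i * u t i ≤ innerMu μ (u 0) (u 0) / μ i := by
    rw [le_div_iff₀ (hμ i)]; linarith
  calc |u t i| ≤ 1 + innerMu μ (u 0) (u 0) / μ i := by
        nlinarith [sq_abs (u t i), sq_nonneg (|u t i| - 1), abs_nonneg (u t i)]
    _ ≤ _ := Finset.single_le_sum (f := fun i => 1 + innerMu μ (u 0) (u 0) / μ i)
        (fun j _ => add_nonneg zero_le_one (div_nonneg (h0 _) (hμ j).le)) (Finset.mem_univ i)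

/-- Bilinear estimate: if `v` and `k` are Poisson extensions, then `⟨v, k⟩_μ` at the boundary is
controlled by the boundary value of the integrated Bellman function. -/
lemma abs_innerMu_le_bellman {q δ r A : ℝ} (hq : 1 < q) (hq2 : q ≤ 2) (hr : 1 ≤ r)
    (hδ : 0 < δ) (hδr : δ * r = q) (hδq : q - δ = 2 - q)
    (hA : A * (q * (q - 1)) = 1 + 8 * (r * 2 ^ (r - 1)))
    (hm : 1 ≤ m) (hμ : ∀ i, 0 < μ i) (hμ1 : ∑ i, μ i = 1)
    (hL : ∀ i j, i ≠ j → L i j ≤ 0) (hL1 : ∀ i, ∑ j, L i j = 0)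
    (hLμ : ∀ i j, μ i * L i j = μ j * L j i) (hΓ : ∀ f i, 0 ≤ gradForm2 L f i)
    (hSS : S * S = L) (hSsymm : ∀ f g, innerMu μ (S.mulVec f) g = innerMu μ f (S.mulVec g))
    (hSpos : ∀ f, 0 ≤ innerMu μ f (S.mulVec f)) (f k₀ : Fin m → ℝ) (hk₀ : ∀ i, 0 < k₀ i)
    (hfk : ∀ i, gradForm L f f i ≤ k₀ i ^ δ) :
    |innerMu μ (S.mulVec f) k₀|
      ≤ 2 * ∑ i, μ i * ((gradForm L f f i + k₀ i ^ δ) ^ r + A * k₀ i ^ q) := by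
  set c : Fin m → Fin m → ℝ := fun i j => if i = j then 0 else -L i j with hc_def
  have hLc : ∀ g i, L.mulVec g i = ∑ j, c i j * (g i - g j) := mulVec_eq_sum_sub hL1
  have hc : ∀ i j, 0 ≤ c i j := by
    intro i j
    by_cases h : i = j
    · simp [hc_def, h]
    · simpa [hc_def, h] using hL i j h
  have hsymm : ∀ i j, μ i * c i j = μ j * c j i := by
    intro i j
    by_cases h : i = j
    · simp [h]
    · simpa [hc_def, h, Ne.symm h] using hLμ i j
  clear_value c
  have hSS' : ∀ g, S.mulVec (S.mulVec g) = L.mulVec g := fun g => by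
    rw [Matrix.mulVec_mulVec, hSS]
  obtain ⟨u, hu0, hu⟩ := exists_hasDerivAt_neg_mulVec S f
  obtain ⟨k, hk0, hk⟩ := exists_hasDerivAt_neg_mulVec S k₀
  have hneg : ∀ g : Fin m → ℝ, ∀ i, S.mulVec (fun i => -g i) i = -S.mulVec g i := fun g i =>
    congrFun (Matrix.mulVec_neg g S) i
  have hSu : ∀ t i, HasDerivAt (fun s => S.mulVec (u s) i) (-L.mulVec (u t) i) t := fun t i => by
    refine (hasDerivAt_mulVec S (hu t) i).congr_deriv ?_
    rw [hneg, hSS']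
  have hSk : ∀ t i, HasDerivAt (fun s => S.mulVec (k s) i) (-L.mulVec (k t) i) t := fun t i => by
    refine (hasDerivAt_mulVec S (hk t) i).congr_deriv ?_
    rw [hneg, hSS']
  obtain ⟨Ku, hKu⟩ := flow_bounded hμ hSpos hu
  obtain ⟨Kk, hKk⟩ := flow_bounded hμ hSpos hk
  obtain ⟨Kv, hKv⟩ := flow_bounded hμ hSpos (u := fun t => S.mulVec (u t)) fun t i => by
    simpa [hSS'] using hSu t i
  -- the Poisson extension of `k₀` stays positive
  have hkpos : ∀ t, 0 ≤ t → ∀ i, 0 < k t i := by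
    have : Nonempty (Fin m) := ⟨⟨0, hm⟩⟩
    obtain ⟨i₀, hi₀⟩ := Finite.exists_min k₀
    intro t ht i
    have h := superharmonic_nonneg hμ hμ1 hc hsymm (C := -Kk - k₀ i₀)
      (g := fun t i => k t i - k₀ i₀) (g₁ := fun t i => -S.mulVec (k t) i)
      (g₂ := fun t i => L.mulVec (k t) i)
      (fun t _ i => (hk t i).sub_const _) (fun t _ i => (hSk t i).fun_neg.congr_deriv (neg_neg _))
      (fun t _ i => by simp [hLc]) (fun t ht i => by linarith [abs_le.1 (hKk t ht i)])
      (fun i => by rw [hk0]; linarith [hi₀ i]) ht i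
    have := hk₀ i₀
    linarith
  set w : ℝ → Fin m → ℝ := fun t => gradForm L (u t) (u t) with hw_def
  have hwc : ∀ t i, w t i = (∑ j, c i j * ((u t i - u t j) * (u t i - u t j))) / 2 := fun t i =>
    gradForm_eq_sum hLc _ _ i
  set w₁ : ℝ → Fin m → ℝ := fun t i =>
    -∑ j, c i j * ((u t i - u t j) * (S.mulVec (u t) i - S.mulVec (u t) j)) with hw₁_def
  set w₂ : ℝ → Fin m → ℝ := fun t i =>
    ∑ j, c i j * ((S.mulVec (u t) i - S.mulVec (u t) j) * (S.mulVec (u t) i - S.mulVec (u t) j)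
      + (u t i - u t j) * (L.mulVec (u t) i - L.mulVec (u t) j)) with hw₂_def
  have hw₁ : ∀ t i, HasDerivAt (fun s => w s i) (w₁ t i) t := by
    intro t i
    simp only [hwc]
    refine ((HasDerivAt.fun_sum fun j _ => (((hu t i).sub (hu t j)).mul
      ((hu t i).sub (hu t j))).const_mul (c i j)).div_const 2).congr_deriv ?_
    simp only [hw₁_def, ← Finset.sum_neg_distrib]
    rw [Finset.sum_div]
    exact Finset.sum_congr rfl fun j _ => by simp only [Pi.sub_apply]; ring
  have hw₂ : ∀ t i, HasDerivAt (fun s => w₁ s i) (w₂ t i) t := by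
    intro t i
    refine (HasDerivAt.fun_sum fun j _ => (((hu t i).sub (hu t j)).mul
      ((hSu t i).sub (hSu t j))).const_mul (c i j)).neg.congr_deriv ?_
    simp only [hw₂_def, ← Finset.sum_neg_distrib]
    exact Finset.sum_congr rfl fun j _ => by simp only [Pi.sub_apply]; ring
  have hw_nonneg : ∀ t i, 0 ≤ w t i := fun t i => by
    rw [hwc]
    exact div_nonneg (Finset.sum_nonneg fun j _ => mul_nonneg (hc i j) (mul_self_nonneg _))
      zero_le_two
  have hw_sub : ∀ t i, ∑ j, c i j * (S.mulVec (u t) i - S.mulVec (u t) j) ^ 2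
      + ∑ j, c i j * (w t i - w t j) ≤ w₂ t i := by
    intro t i
    have h1 := hΓ (u t) i
    have h2 : w₂ t i = ∑ j, c i j * (S.mulVec (u t) i - S.mulVec (u t) j) ^ 2
        + 2 * gradForm L (L.mulVec (u t)) (u t) i := by
      rw [gradForm_eq_sum hLc]
      simp only [hw₂_def]
      rw [mul_div_cancel₀ _ two_ne_zero, ← Finset.sum_add_distrib]
      exact Finset.sum_congr rfl fun j _ => by ring
    rw [gradForm2, hLc] at h1
    simp only [hw_def] at h2 ⊢
    linarith
  obtain ⟨W, hW⟩ : ∃ W, ∀ t, 0 ≤ t → ∀ i, w t i ≤ W := by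
    refine ⟨∑ i, (∑ j, c i j * (2 * Ku) ^ 2) / 2, fun t ht i => ?_⟩
    have h0 : ∀ i, 0 ≤ (∑ j, c i j * (2 * Ku) ^ 2) / 2 := fun i =>
      div_nonneg (Finset.sum_nonneg fun j _ => mul_nonneg (hc i j) (sq_nonneg _)) zero_le_two
    refine le_trans ?_ (Finset.single_le_sum (fun i _ => h0 i) (Finset.mem_univ i))
    rw [hwc]
    refine div_le_div_of_nonneg_right (Finset.sum_le_sum fun j _ =>
      mul_le_mul_of_nonneg_left ?_ (hc i j)) zero_le_two
    rw [← pow_two]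
    have hi := abs_le.1 (hKu t ht i)
    have hj := abs_le.1 (hKu t ht j)
    exact sq_le_sq' (by linarith) (by linarith)
  have hkδ₁ : ∀ (a : ℝ) t, 0 ≤ t → ∀ i, HasDerivAt (fun s => k s i ^ a)
      (a * k t i ^ (a - 1) * -S.mulVec (k t) i) t := by
    intro a t ht i
    refine ((hk t i).rpow_const (Or.inl (hkpos t ht i).ne')).congr_deriv ?_
    ring
  have hkδ₂ : ∀ (a : ℝ) t, 0 ≤ t → ∀ i,
      HasDerivAt (fun s => a * k s i ^ (a - 1) * -S.mulVec (k s) i)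
      (a * ((a - 1) * k t i ^ (a - 2) * (-S.mulVec (k t) i) ^ 2
        + k t i ^ (a - 1) * L.mulVec (k t) i)) t := by
    intro a t ht i
    refine (((hkδ₁ (a - 1) t ht i).const_mul a).mul (hSk t i).fun_neg).congr_deriv ?_
    rw [show a - 1 - 1 = a - 2 by ring]
    ring
  -- the constraint `w ≤ k ^ δ` propagates when `δ ≤ 1`
  have hwk : ∀ t, 0 ≤ t → 1 ≤ δ ∨ ∀ i, w t i ≤ k t i ^ δ := by
    intro t ht
    by_cases hδ1 : 1 ≤ δ
    · exact Or.inl hδ1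
    refine Or.inr fun i => ?_
    push Not at hδ1
    have h := superharmonic_nonneg hμ hμ1 hc hsymm (C := -W)
      (g := fun t i => k t i ^ δ - w t i)
      (fun t ht i => (hkδ₁ δ t ht i).sub (hw₁ t i))
      (fun t ht i => (hkδ₂ δ t ht i).sub (hw₂ t i))
      (fun t ht i => ?_) (fun t ht i => ?_) (fun i => ?_) ht i
    · simpa using h
    · have h1 := hw_sub t i
      have h2 : 0 ≤ ∑ j, c i j * (S.mulVec (u t) i - S.mulVec (u t) j) ^ 2 :=
        Finset.sum_nonneg fun j _ => mul_nonneg (hc i j) (sq_nonneg _)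
      have hki := hkpos t ht i
      have h3 : δ * ((δ - 1) * k t i ^ (δ - 2) * (-S.mulVec (k t) i) ^ 2) ≤ 0 := by
        have : 0 ≤ δ * ((1 - δ) * k t i ^ (δ - 2) * (-S.mulVec (k t) i) ^ 2) := by
          have : 0 ≤ 1 - δ := by linarith
          positivity
        linarith
      have h4 : δ * k t i ^ (δ - 1) * L.mulVec (k t) i
          ≤ ∑ j, c i j * (k t i ^ δ - k t j ^ δ) := by
        rw [hLc, Finset.mul_sum]
        refine Finset.sum_le_sum fun j _ => ?_
        have := rpow_le_tangent hδ.le hδ1.le hki (hkpos t ht j)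
        have := mul_le_mul_of_nonneg_left (a := c i j) (b := δ * k t i ^ (δ - 1) * (k t i - k t j))
          (c := k t i ^ δ - k t j ^ δ) (by linarith) (hc i j)
        linarith
      have h5 : ∑ j, c i j * (k t i ^ δ - w t i - (k t j ^ δ - w t j))
          = ∑ j, c i j * (k t i ^ δ - k t j ^ δ) - ∑ j, c i j * (w t i - w t j) := by
        rw [← Finset.sum_sub_distrib]
        exact Finset.sum_congr rfl fun j _ => by ring
      rw [h5]
      linarith
    · have := Real.rpow_pos_of_pos (hkpos t ht i) δ
      linarith [hW t ht i]
    · have := hfk i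
      simp only [hw_def, hu0, hk0]
      linarith
  -- the integrated Bellman function and its derivatives
  set b : ℝ → ℝ := fun t => ∑ i, μ i * ((w t i + k t i ^ δ) ^ r + A * k t i ^ q) with hb_def
  have hs_pos : ∀ t, 0 ≤ t → ∀ i, 0 < w t i + k t i ^ δ := fun t ht i =>
    add_pos_of_nonneg_of_pos (hw_nonneg t i) (Real.rpow_pos_of_pos (hkpos t ht i) δ)
  have hs₁ : ∀ (a : ℝ) t, 0 ≤ t → ∀ i, HasDerivAt (fun s => (w s i + k s i ^ δ) ^ a)
      (a * (w t i + k t i ^ δ) ^ (a - 1)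
        * (w₁ t i + δ * k t i ^ (δ - 1) * -S.mulVec (k t) i)) t := by
    intro a t ht i
    refine (((hw₁ t i).add (hkδ₁ δ t ht i)).rpow_const
      (Or.inl (hs_pos t ht i).ne')).congr_deriv ?_
    simp only [Pi.add_apply]
    ring
  set b₁ : ℝ → ℝ := fun t => ∑ i, μ i * (r * (w t i + k t i ^ δ) ^ (r - 1)
        * (w₁ t i + δ * k t i ^ (δ - 1) * -S.mulVec (k t) i)
      + A * (q * k t i ^ (q - 1) * -S.mulVec (k t) i)) with hb₁_def
  have hb₁ : ∀ t, 0 ≤ t → HasDerivAt b (b₁ t) t := fun t ht =>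
    HasDerivAt.fun_sum fun i _ =>
      ((hs₁ r t ht i).add ((hkδ₁ q t ht i).const_mul A)).const_mul (μ i)
  set b₂ : ℝ → ℝ := fun t => ∑ i, μ i * (r * ((r - 1) * (w t i + k t i ^ δ) ^ (r - 2)
          * (w₁ t i + δ * k t i ^ (δ - 1) * -S.mulVec (k t) i) ^ 2
          + (w t i + k t i ^ δ) ^ (r - 1) * (w₂ t i
            + δ * ((δ - 1) * k t i ^ (δ - 2) * (-S.mulVec (k t) i) ^ 2
            + k t i ^ (δ - 1) * L.mulVec (k t) i)))
        + A * (q * ((q - 1) * k t i ^ (q - 2) * (-S.mulVec (k t) i) ^ 2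
            + k t i ^ (q - 1) * L.mulVec (k t) i))) with hb₂_def
  have hb₂ : ∀ t, 0 ≤ t → HasDerivAt b₁ (b₂ t) t := by
    intro t ht
    refine HasDerivAt.fun_sum fun i _ => HasDerivAt.const_mul (μ i) ?_
    refine ((((hs₁ (r - 1) t ht i).const_mul r).mul
      ((hw₂ t i).add (hkδ₂ δ t ht i))).add ((hkδ₂ q t ht i).const_mul A)).congr_deriv ?_
    rw [show r - 1 - 1 = r - 2 by ring]
    simp only [Pi.add_apply]
    ring
  set y : ℝ → ℝ := fun t => innerMu μ (S.mulVec (u t)) (k t) with hy_def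
  set y₂ : ℝ → ℝ := fun t => 4 * innerMu μ (L.mulVec (S.mulVec (u t))) (k t) with hy₂_def
  have hLsymm : ∀ g h, innerMu μ (L.mulVec g) h = innerMu μ g (L.mulVec h) := fun g h => by
    rw [← hSS', ← hSS', hSsymm, hSsymm]
  have hLS : ∀ g, L.mulVec (S.mulVec g) = S.mulVec (L.mulVec g) := fun g => by
    rw [← hSS', ← hSS']
  have hy₁ : ∀ t, HasDerivAt y (-2 * innerMu μ (L.mulVec (u t)) (k t)) t := by
    intro t
    refine (hasDerivAt_innerMu (hSu t) (hk t)).congr_deriv ?_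
    rw [innerMu_neg_left, innerMu_neg_right, ← hSsymm, hSS']
    ring
  have hy₂ : ∀ t, HasDerivAt (fun t => -2 * innerMu μ (L.mulVec (u t)) (k t)) (y₂ t) t := by
    intro t
    refine ((hasDerivAt_innerMu (hasDerivAt_mulVec L (hu t)) (hk t)).const_mul (-2)).congr_deriv ?_
    have e : L.mulVec (fun i => -S.mulVec (u t) i) = fun i => -L.mulVec (S.mulVec (u t)) i :=
      Matrix.mulVec_neg _ L
    rw [e, innerMu_neg_left, innerMu_neg_right, ← hSsymm, ← hLS]
    ring
  have hyb : ∀ t, 0 ≤ t → |y₂ t| ≤ 2 * b₂ t := by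
    intro t ht
    have h1 := bellman_sum_lower hq hq2 hr hδ hδr hδq hA hμ hc hsymm (hkpos t ht)
      (hw_nonneg t) (hwk t ht) (w₁ := w₁ t) (k₁ := fun i => -S.mulVec (k t) i)
      (hLc (k t)) (hw_sub t)
    have h2 : y₂ t = 2 * ∑ i, ∑ j, μ i * c i j
        * ((S.mulVec (u t) i - S.mulVec (u t) j) * (k t i - k t j)) := by
      have h3 := sum_reversible_green hsymm (S.mulVec (u t)) (k t)
      have h4 : y₂ t = 4 * ∑ i, ∑ j, μ i * c i j * (S.mulVec (u t) i * (k t i - k t j)) := by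
        simp only [hy₂_def]
        rw [hLsymm, innerMu]
        simp only [hLc (k t), Finset.mul_sum]
        exact Finset.sum_congr rfl fun i _ => Finset.sum_congr rfl fun j _ => by ring
      linarith
    have h5 : |∑ i, ∑ j, μ i * c i j
        * ((S.mulVec (u t) i - S.mulVec (u t) j) * (k t i - k t j))| ≤ b₂ t := by
      refine le_trans ?_ h1
      refine (Finset.abs_sum_le_sum_abs _ _).trans (Finset.sum_le_sum fun i _ => ?_)
      refine (Finset.abs_sum_le_sum_abs _ _).trans (Finset.sum_le_sum fun j _ => ?_)
      rw [abs_mul (μ i * c i j), abs_of_nonneg (mul_nonneg (hμ i).le (hc i j)), abs_mul]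
    rw [h2, abs_mul, abs_two]
    linarith
  have hA0 : 0 ≤ A := by
    have h0 : 0 < q * (q - 1) := by nlinarith
    have h : 0 < A * (q * (q - 1)) := by rw [hA]; positivity
    exact (pos_of_mul_pos_left h h0.le).le
  have hb_nonneg : ∀ t, 0 ≤ t → 0 ≤ b t := by
    intro t ht
    refine Finset.sum_nonneg fun i _ => mul_nonneg (hμ i).le (add_nonneg ?_ (mul_nonneg hA0 ?_))
    · exact Real.rpow_nonneg (hs_pos t ht i).le r
    · exact Real.rpow_nonneg (hkpos t ht i).le q
  have hsum_bound : ∀ (F G : Fin m → ℝ) (K K' : ℝ), (∀ i, |F i| ≤ K) → (∀ i, |G i| ≤ K') →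
      |innerMu μ F G| ≤ K * K' := by
    intro F G K K' hF hG
    calc |innerMu μ F G| ≤ ∑ i, |μ i * F i * G i| := Finset.abs_sum_le_sum_abs _ _
      _ ≤ ∑ i, μ i * (K * K') := by
        refine Finset.sum_le_sum fun i _ => ?_
        rw [mul_assoc, abs_mul, abs_of_pos (hμ i), abs_mul]
        exact mul_le_mul_of_nonneg_left (mul_le_mul (hF i) (hG i) (abs_nonneg _)
          ((abs_nonneg _).trans (hF i))) (hμ i).le
      _ = K * K' := by rw [← Finset.sum_mul, hμ1, one_mul]
  have hb_bdd : ∀ t, 0 ≤ t → b t ≤ (W + Kk ^ δ) ^ r + A * Kk ^ q := by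
    intro t ht
    calc b t ≤ ∑ i, μ i * ((W + Kk ^ δ) ^ r + A * Kk ^ q) := by
          refine Finset.sum_le_sum fun i _ => mul_le_mul_of_nonneg_left ?_ (hμ i).le
          have h0 := (hkpos t ht i).le
          have h1 := (le_abs_self _).trans (hKk t ht i)
          have h2 := Real.rpow_le_rpow h0 h1 hδ.le
          have h3 := Real.rpow_le_rpow h0 h1 (by linarith : 0 ≤ q)
          have h4 := Real.rpow_le_rpow (hs_pos t ht i).le (add_le_add (hW t ht i) h2)
            (by linarith : 0 ≤ r)
          exact add_le_add h4 (mul_le_mul_of_nonneg_left h3 hA0)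
      _ = _ := by rw [← Finset.sum_mul, hμ1, one_mul]
  have hfinal : ∀ σ : ℝ, |σ| = 1 → σ * y 0 ≤ 2 * b 0 := by
    intro σ hσ
    by_contra! hcon
    have h1 : ∀ t, 0 ≤ t → 2 * b t - σ * y t ≤ 2 * b 0 - σ * y 0 := by
      intro t ht
      refine le_initial_of_deriv2_nonneg_of_bddAbove (g := fun t => 2 * b t - σ * y t)
        (C := 2 * ((W + Kk ^ δ) ^ r + A * Kk ^ q) + Kv * Kk)
        (fun t ht => ((hb₁ t ht).const_mul 2).sub ((hy₁ t).const_mul σ))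
        (fun t ht => ((hb₂ t ht).const_mul 2).sub ((hy₂ t).const_mul σ)) ?_ ?_ ht
      · intro t ht
        have h2 : σ * y₂ t ≤ |y₂ t| := by
          calc σ * y₂ t ≤ |σ * y₂ t| := le_abs_self _
            _ = |y₂ t| := by rw [abs_mul, hσ, one_mul]
        linarith [hyb t ht]
      · intro t ht
        have h2 : -(σ * y t) ≤ |y t| := by
          calc -(σ * y t) ≤ |σ * y t| := neg_le_abs _
            _ = |y t| := by rw [abs_mul, hσ, one_mul]
        have h3 : |y t| ≤ Kv * Kk := hsum_bound _ _ _ _ (hKv t ht) (hKk t ht)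
        linarith [hb_bdd t ht]
    set e := σ * y 0 - 2 * b 0 with he
    have he0 : 0 < e := by linarith
    have h2 : ∀ t, HasDerivAt (fun t => innerMu μ (u t) (k t)) (-2 * y t) t := by
      intro t
      refine (hasDerivAt_innerMu (hu t) (hk t)).congr_deriv ?_
      rw [innerMu_neg_left, innerMu_neg_right, ← hSsymm]
      ring
    have h3 : ∀ t, 0 ≤ t → σ * innerMu μ (u t) (k t) + 2 * e * t
        ≤ σ * innerMu μ (u 0) (k 0) + 2 * e * 0 := fun t ht =>
      le_initial_of_deriv_nonpos (g := fun t => σ * innerMu μ (u t) (k t) + 2 * e * t)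
        (fun t _ => ((h2 t).const_mul σ).add ((hasDerivAt_id t).const_mul (2 * e)))
        (fun t ht => by linarith [h1 t ht, hb_nonneg t ht]) ht
    have h4 : ∀ t, 0 ≤ t → |σ * innerMu μ (u t) (k t)| ≤ Ku * Kk := fun t ht => by
      rw [abs_mul, hσ, one_mul]
      exact hsum_bound _ _ _ _ (hKu t ht) (hKk t ht)
    have hK : 0 ≤ Ku * Kk := (abs_nonneg _).trans (h4 0 le_rfl)
    have hT : 0 ≤ (Ku * Kk + 1) / e := by positivity
    have h5 := h3 _ hT
    have h6 : 2 * e * ((Ku * Kk + 1) / e) = 2 * (Ku * Kk + 1) := by field_simp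
    have h7 := abs_le.1 (h4 _ hT)
    have h8 := abs_le.1 (h4 0 le_rfl)
    linarith
  have hb0 : b 0 = ∑ i, μ i * ((gradForm L f f i + k₀ i ^ δ) ^ r + A * k₀ i ^ q) := by
    simp only [hb_def, hw_def, hu0, hk0]
  have hy0 : y 0 = innerMu μ (S.mulVec f) k₀ := by simp only [hy_def, hu0, hk0]
  rw [← hb0, ← hy0, abs_le]
  have h1 := hfinal 1 abs_one
  have h2 := hfinal (-1) (by simp)
  constructor <;> linarith

end Flow

lemma add_add_rpow_le {q x y z : ℝ} (hq : 0 ≤ q) (hx : 0 ≤ x) (hy : 0 ≤ y) (hz : 0 ≤ z) :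
    (x + y + z) ^ q ≤ 3 ^ q * (x ^ q + y ^ q + z ^ q) := by
  have hx' := Real.rpow_nonneg hx q
  have hy' := Real.rpow_nonneg hy q
  have hz' := Real.rpow_nonneg hz q
  obtain ⟨M, hM, hMq, hxM, hyM, hzM⟩ : ∃ M, 0 ≤ M ∧ M ^ q ≤ x ^ q + y ^ q + z ^ q ∧
      x ≤ M ∧ y ≤ M ∧ z ≤ M := by
    rcases le_total x y with h | h
    · rcases le_total y z with h' | h'
      · exact ⟨z, hz, by linarith, by linarith, h', le_rfl⟩
      · exact ⟨y, hy, by linarith, h, le_rfl, h'⟩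
    · rcases le_total x z with h' | h'
      · exact ⟨z, hz, by linarith, h', by linarith, le_rfl⟩
      · exact ⟨x, hx, by linarith, le_rfl, h, h'⟩
  calc (x + y + z) ^ q ≤ (3 * M) ^ q := Real.rpow_le_rpow (by positivity) (by linarith) hq
    _ = 3 ^ q * M ^ q := Real.mul_rpow (by norm_num) hM
    _ ≤ _ := by gcongr

/-- A nonlinear dual bound for `h` against admissible positive functions implies an
`L_p` estimate. -/
lemma sum_abs_rpow_le_of_dual_bound {ι : Type*} [Fintype ι] {μ h w : ι → ℝ} {p q δ r C : ℝ}
    (hp : 1 ≤ p) (hq : 0 < q) (hpq : (p - 1) * q = p) (hδ : 0 < δ) (hδr : δ * r = q)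
    (hC : 0 < C) (hμ : ∀ i, 0 < μ i) (hμ1 : ∑ i, μ i = 1) (hw : ∀ i, 0 ≤ w i)
    (H : ∀ k : ι → ℝ, (∀ i, 0 < k i) → (∀ i, w i ≤ k i ^ δ) →
      |∑ i, μ i * h i * k i| ≤ C * ∑ i, μ i * k i ^ q) :
    ∑ i, μ i * |h i| ^ p ≤ (4 * C * 3 ^ q) ^ p * ∑ i, μ i * w i ^ r := by
  set P := ∑ i, μ i * |h i| ^ p with hP
  set Q := ∑ i, μ i * w i ^ r with hQ
  set K := 2 * C * 3 ^ q with hK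
  have hK0 : 0 < K := by positivity
  have hτ : ∀ τ : ℝ, 0 < τ → τ * P ≤ K * (Q + τ ^ q * P) := by
    intro τ hτ
    refine le_of_forall_pos_le_add fun η hη => ?_
    obtain ⟨ε, hε, hεη⟩ : ∃ ε : ℝ, 0 < ε ∧ K * ε ^ q = η :=
      ⟨(η / K) ^ q⁻¹, by positivity, by
        rw [Real.rpow_inv_rpow (by positivity) hq.ne']; field_simp⟩
    set φ : ι → ℝ := fun i => τ * |h i| ^ (p - 1) with hφ
    have hφ0 : ∀ i, 0 ≤ φ i := fun i => by positivity
    have hw0 : ∀ i, 0 ≤ w i ^ δ⁻¹ := fun i => Real.rpow_nonneg (hw i) _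
    have hbound : ∀ χ : ι → ℝ, (∀ i, 0 ≤ χ i) → (∀ i, χ i ≤ φ i) →
        |∑ i, μ i * h i * (w i ^ δ⁻¹ + ε + χ i)| ≤ C * (3 ^ q * (Q + ε ^ q + τ ^ q * P)) := by
      intro χ hχ hχφ
      refine (H (fun i => w i ^ δ⁻¹ + ε + χ i) (fun i => by linarith [hw0 i, hχ i])
        fun i => ?_).trans (mul_le_mul_of_nonneg_left ?_ hC.le)
      · calc w i = (w i ^ δ⁻¹) ^ δ := (Real.rpow_inv_rpow (hw i) hδ.ne').symm
          _ ≤ _ := Real.rpow_le_rpow (hw0 i) (by linarith [hχ i]) hδ.le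
      · have h1 : ∀ i, μ i * (w i ^ δ⁻¹ + ε + χ i) ^ q
            ≤ 3 ^ q * (μ i * w i ^ r + μ i * ε ^ q + τ ^ q * (μ i * |h i| ^ p)) := by
          intro i
          have h2 := add_add_rpow_le hq.le (hw0 i) hε.le (hφ0 i)
          have h3 : (w i ^ δ⁻¹) ^ q = w i ^ r := by
            rw [← Real.rpow_mul (hw i), ← hδr, inv_mul_cancel_left₀ hδ.ne']
          have h4 : φ i ^ q = τ ^ q * |h i| ^ p := by
            rw [hφ, Real.mul_rpow hτ.le (by positivity), ← Real.rpow_mul (abs_nonneg _), hpq]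
          have h5 := Real.rpow_le_rpow (by linarith [hw0 i, hχ i])
            (by linarith [hχφ i] : w i ^ δ⁻¹ + ε + χ i ≤ w i ^ δ⁻¹ + ε + φ i) hq.le
          rw [h3, h4] at h2
          calc _ ≤ _ := mul_le_mul_of_nonneg_left (h5.trans h2) (hμ i).le
            _ = _ := by ring
        refine (Finset.sum_le_sum fun i _ => h1 i).trans_eq ?_
        rw [← Finset.mul_sum, Finset.sum_add_distrib, Finset.sum_add_distrib, ← Finset.sum_mul,
          ← Finset.mul_sum, hμ1, one_mul]
    have hpos := hbound (fun i => if 0 ≤ h i then φ i else 0)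
      (fun i => by split_ifs <;> simp [hφ0 i])
      (fun i => by split_ifs <;> simp [hφ0 i])
    have hneg := hbound (fun i => if 0 ≤ h i then 0 else φ i)
      (fun i => by split_ifs <;> simp [hφ0 i])
      (fun i => by split_ifs <;> simp [hφ0 i])
    have hsub : τ * P = ∑ i, μ i * h i * (w i ^ δ⁻¹ + ε + if 0 ≤ h i then φ i else 0)
        - ∑ i, μ i * h i * (w i ^ δ⁻¹ + ε + if 0 ≤ h i then 0 else φ i) := by
      rw [hP, Finset.mul_sum, ← Finset.sum_sub_distrib]
      refine Finset.sum_congr rfl fun i _ => ?_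
      have h1 : |h i| ^ p = |h i| * |h i| ^ (p - 1) := by
        rw [← Real.rpow_one_add' (abs_nonneg _) (by linarith), add_sub_cancel]
      rw [h1]
      split_ifs with hi
      · simp only [hφ, abs_of_nonneg hi]; ring
      · simp only [hφ, abs_of_neg (not_le.1 hi)]; ring
    have e : K * (Q + τ ^ q * P) + η = 2 * (C * (3 ^ q * (Q + ε ^ q + τ ^ q * P))) := by
      rw [← hεη]; ring
    rw [e, hsub]
    linarith [(abs_le.1 hpos).2, (abs_le.1 hneg).1]
  have hD0 : 0 < 2 * K := by positivity
  have h1 := hτ ((2 * K) ^ (1 - p)) (by positivity)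
  have h2 : ((2 * K) ^ (1 - p)) ^ q = (2 * K) ^ (-p) := by
    rw [← Real.rpow_mul hD0.le]
    congr 1
    linarith
  have h3 : (2 * K) ^ (1 - p) = 2 * K * (2 * K) ^ (-p) := by
    rw [sub_eq_add_neg, Real.rpow_add hD0, Real.rpow_one]
  have h4 : (2 * K) ^ p * (2 * K) ^ (-p) = 1 := by
    rw [← Real.rpow_add hD0]; simp
  rw [h2, h3] at h1
  have h5 : K * ((2 * K) ^ (-p) * P) ≤ K * Q := by linarith
  have h6 := mul_le_mul_of_nonneg_left (le_of_mul_le_mul_left h5 hK0)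
    (Real.rpow_nonneg hD0.le p)
  rw [← mul_assoc, h4, one_mul] at h6
  rwa [show 4 * C * 3 ^ q = 2 * K by rw [hK]; ring]

/-- Commutative, finite-state instance of the main Riesz transform estimate:
`‖A^{1/2} f‖_p ≤ c(p) ‖Γ(f,f)^{1/2}‖_p` under `Γ² ≥ 0`, with `S = A^{1/2}` any
self-adjoint positive square root of `L` with respect to `⟨·,·⟩_μ`. -/
theorem riesz_transform_finite_markov (p : ℝ) (hp : 2 ≤ p) :
    ∃ c : ℝ, ∀ (m : ℕ), 1 ≤ m →
      ∀ (μ : Fin m → ℝ) (L : Matrix (Fin m) (Fin m) ℝ),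
        (∀ i, 0 < μ i) → (∑ i, μ i) = 1 →
        (∀ i j, i ≠ j → L i j ≤ 0) →
        (∀ i, ∑ j, L i j = 0) →
        (∀ i j, μ i * L i j = μ j * L j i) →
        (∀ f : Fin m → ℝ, ∀ i, 0 ≤ gradForm2 L f i) →
        ∀ S : Matrix (Fin m) (Fin m) ℝ,
          S * S = L →
          (∀ f g : Fin m → ℝ, innerMu μ (S.mulVec f) g = innerMu μ f (S.mulVec g)) →
          (∀ f : Fin m → ℝ, 0 ≤ innerMu μ f (S.mulVec f)) →
          ∀ f : Fin m → ℝ,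
            lpNormMu μ p (S.mulVec f) ≤
              c * lpNormMu μ p (fun i => Real.sqrt (gradForm L f f i)) := by
  have hp1 : 0 < p - 1 := by linarith
  set q := p / (p - 1) with hq_def
  set δ := 2 / (p - 1) with hδ_def
  set r := p / 2 with hr_def
  have hq : 1 < q := by rw [hq_def, lt_div_iff₀ hp1]; linarith
  have hq2 : q ≤ 2 := by rw [hq_def, div_le_iff₀ hp1]; linarith
  have hr : 1 ≤ r := by rw [hr_def]; linarith
  have hδ : 0 < δ := by positivity
  have hδr : δ * r = q := by rw [hδ_def, hr_def, hq_def]; field_simp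
  have hδq : q - δ = 2 - q := by rw [hδ_def, hq_def]; field_simp; ring
  have hqq : 0 < q * (q - 1) := mul_pos (by linarith) (by linarith)
  obtain ⟨A, hA, hA0⟩ : ∃ A : ℝ, A * (q * (q - 1)) = 1 + 8 * (r * 2 ^ (r - 1)) ∧ 0 < A :=
    ⟨(1 + 8 * (r * 2 ^ (r - 1))) / (q * (q - 1)), div_mul_cancel₀ _ hqq.ne', by positivity⟩
  refine ⟨4 * (2 * (2 ^ r + A)) * 3 ^ q, ?_⟩
  intro m hm μ L hμ hμ1 hL hL1 hLμ hΓ S hSS hSsymm hSpos f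
  have hw : ∀ i, 0 ≤ gradForm L f f i := fun i => by
    rw [gradForm_eq_sum (mulVec_eq_sum_sub hL1)]
    refine div_nonneg (Finset.sum_nonneg fun j _ => mul_nonneg ?_ (mul_self_nonneg (f i - f j)))
      zero_le_two
    split_ifs with h
    · exact le_rfl
    · linarith [hL i j h]
  have key := sum_abs_rpow_le_of_dual_bound (h := S.mulVec f) (p := p) (q := q) (δ := δ) (r := r)
    (C := 2 * (2 ^ r + A)) (by linarith) (by linarith) (mul_div_cancel₀ _ hp1.ne') hδ hδr
    (by positivity) hμ hμ1 hw fun k hk hfk => by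
      refine (abs_innerMu_le_bellman hq hq2 hr hδ hδr hδq hA hm hμ hμ1 hL hL1 hLμ hΓ hSS hSsymm
        hSpos f k hk hfk).trans ?_
      rw [mul_assoc, Finset.mul_sum (a := 2 ^ r + A)]
      refine mul_le_mul_of_nonneg_left (Finset.sum_le_sum fun i _ => ?_) (zero_le_two (α := ℝ))
      have h1 : (gradForm L f f i + k i ^ δ) ^ r ≤ 2 ^ r * k i ^ q := by
        have h2 : 0 ≤ k i ^ δ := (Real.rpow_pos_of_pos (hk i) δ).le
        rw [← hδr, Real.rpow_mul (hk i).le, ← Real.mul_rpow zero_le_two h2]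
        exact Real.rpow_le_rpow (add_nonneg (hw i) h2) (by linarith [hfk i]) (by linarith)
      calc _ ≤ μ i * (2 ^ r * k i ^ q + A * k i ^ q) :=
            mul_le_mul_of_nonneg_left (by linarith) (hμ i).le
        _ = _ := by ring
  have hsqrt : ∀ i, |Real.sqrt (gradForm L f f i)| ^ p = gradForm L f f i ^ r := fun i => by
    rw [abs_of_nonneg (Real.sqrt_nonneg _), Real.sqrt_eq_rpow, ← Real.rpow_mul (hw i), hr_def]
    ring_nf
  have hc0 : 0 ≤ 4 * (2 * (2 ^ r + A)) * 3 ^ q := by positivity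
  have hW : 0 ≤ ∑ i, μ i * gradForm L f f i ^ r :=
    Finset.sum_nonneg fun i _ => mul_nonneg (hμ i).le (Real.rpow_nonneg (hw i) _)
  simp only [lpNormMu, hsqrt]
  calc _ ≤ _ := Real.rpow_le_rpow (Finset.sum_nonneg fun i _ =>
        mul_nonneg (hμ i).le (Real.rpow_nonneg (abs_nonneg _) _)) key (by positivity)
    _ = _ := by
      rw [Real.mul_rpow (by positivity) hW, ← Real.rpow_mul hc0,
        mul_one_div_cancel (by linarith), Real.rpow_one]
end

section
/- (Proposition 4.4(i), commutative kernel version.) In the Markov kernel semigroup setup, for every bounded measurable f : Ω → ℝ, all s, t > 0 and every x ∈ Ω: 0 ≤ T_t((T_s f)²)(x) − (T_{t+s} f(x))² ≤ T_{t+s}(f²)(x) − (T_{t+s} f(x))². Consequently ‖T_s f‖_{BMO_c(T)} ≤ ‖f‖_{BMO_c(T)} for every s > 0. -/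
open MeasureTheory ProbabilityTheory

/-- `T_t f(x) = ∫ f dκ_t(x)` for a family of kernels. -/
noncomputable def Tker {Ω : Type*} [MeasurableSpace Ω] (κ : ℝ → Kernel Ω Ω)
    (t : ℝ) (f : Ω → ℝ) (x : Ω) : ℝ :=
  ∫ y, f y ∂(κ t x)

/-- Garsia-type BMO norm `‖f‖_{BMO_c(T)} = sup_{t>0} sup_x (T_t(f²)(x) − (T_t f(x))²)^{1/2}`. -/
noncomputable def bmoC {Ω : Type*} [MeasurableSpace Ω] (κ : ℝ → Kernel Ω Ω)
    (f : Ω → ℝ) : ℝ :=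
  ⨆ t : Set.Ioi (0 : ℝ), ⨆ x : Ω,
    Real.sqrt (Tker κ t (fun y => f y ^ 2) x - (Tker κ t f x) ^ 2)

section Helpers

variable {Ω : Type*} [MeasurableSpace Ω]

lemma measurable_Tker {κ : ℝ → Kernel Ω Ω} {t : ℝ} {f : Ω → ℝ} (hf : Measurable f) :
    Measurable (Tker κ t f) :=
  (hf.stronglyMeasurable.integral_kernel (κ := κ t)).measurable

lemma abs_Tker_le {κ : ℝ → Kernel Ω Ω} {t : ℝ} [IsMarkovKernel (κ t)] {f : Ω → ℝ} {C : ℝ}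
    (hC : ∀ x, |f x| ≤ C) (x : Ω) : |Tker κ t f x| ≤ C := by
  simpa [Tker] using
    norm_integral_le_of_norm_le_const (μ := κ t x) (f := f) (C := C) (.of_forall hC)

lemma abs_sq_le_of_abs_le {α : Type*} {f : α → ℝ} {C : ℝ} (hC : ∀ x, |f x| ≤ C) (x : α) :
    |f x ^ 2| ≤ C ^ 2 := by
  rw [abs_pow]
  exact pow_le_pow_left₀ (abs_nonneg _) (hC x) 2

lemma Tker_mono {κ : ℝ → Kernel Ω Ω} {t : ℝ} [IsMarkovKernel (κ t)] {f g : Ω → ℝ} {C D : ℝ}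
    (hf : Measurable f) (hg : Measurable g) (hC : ∀ x, |f x| ≤ C) (hD : ∀ x, |g x| ≤ D)
    (hfg : f ≤ g) (x : Ω) : Tker κ t f x ≤ Tker κ t g x :=
  integral_mono (.of_bound hf.aestronglyMeasurable C (.of_forall hC))
    (.of_bound hg.aestronglyMeasurable D (.of_forall hD)) hfg

/-- Kadison–Schwarz inequality for a Markov kernel. -/
lemma sq_Tker_le {κ : ℝ → Kernel Ω Ω} {t : ℝ} [IsMarkovKernel (κ t)] {f : Ω → ℝ} {C : ℝ}
    (hf : Measurable f) (hC : ∀ x, |f x| ≤ C) (x : Ω) :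
    Tker κ t f x ^ 2 ≤ Tker κ t (fun y => f y ^ 2) x := by
  have hL : MemLp f 2 (κ t x) := .of_bound hf.aestronglyMeasurable C (.of_forall hC)
  have h := variance_nonneg f (κ t x)
  rw [variance_eq_sub hL] at h
  simpa [Tker] using h

lemma sqrt_Tker_sq_sub_le {κ : ℝ → Kernel Ω Ω} {t : ℝ} [IsMarkovKernel (κ t)] {f : Ω → ℝ}
    {C : ℝ} (hC : ∀ x, |f x| ≤ C) (x : Ω) :
    Real.sqrt (Tker κ t (fun y => f y ^ 2) x - Tker κ t f x ^ 2) ≤ C := by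
  refine (Real.sqrt_le_left ((abs_nonneg _).trans (hC x))).2 ?_
  have := (le_abs_self _).trans (abs_Tker_le (κ := κ) (t := t) (abs_sq_le_of_abs_le hC) x)
  linarith [sq_nonneg (Tker κ t f x)]

lemma le_bmoC {κ : ℝ → Kernel Ω Ω} (hmk : ∀ t : ℝ, 0 < t → IsMarkovKernel (κ t)) {f : Ω → ℝ}
    {C : ℝ} (hC : ∀ x, |f x| ≤ C) {t : ℝ} (ht : 0 < t) (x : Ω) :
    Real.sqrt (Tker κ t (fun y => f y ^ 2) x - Tker κ t f x ^ 2) ≤ bmoC κ f := by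
  have hbound (u : Set.Ioi (0 : ℝ)) (y : Ω) :
      Real.sqrt (Tker κ u (fun y => f y ^ 2) y - Tker κ u f y ^ 2) ≤ C :=
    have := hmk u u.2
    sqrt_Tker_sq_sub_le hC y
  have : Nonempty Ω := ⟨x⟩
  refine (le_ciSup (f := fun y => Real.sqrt (Tker κ t (fun y => f y ^ 2) y - Tker κ t f y ^ 2))
    ⟨C, Set.forall_mem_range.2 (hbound ⟨t, ht⟩)⟩ x).trans ?_
  exact le_ciSup (f := fun u : Set.Ioi (0 : ℝ) =>
      ⨆ y, Real.sqrt (Tker κ u (fun y => f y ^ 2) y - Tker κ u f y ^ 2))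
    ⟨C, Set.forall_mem_range.2 fun u => ciSup_le (hbound u)⟩ ⟨t, ht⟩

end Helpers

/-- Proposition 4.4(i), commutative kernel version: for a Markov semigroup of kernels,
`0 ≤ T_t((T_s f)²) − (T_{t+s}f)² ≤ T_{t+s}(f²) − (T_{t+s}f)²` pointwise, and consequently
`‖T_s f‖_{BMO_c(T)} ≤ ‖f‖_{BMO_c(T)}`. -/
theorem bmoC_semigroup_contraction {Ω : Type*} [MeasurableSpace Ω]
    (κ : ℝ → Kernel Ω Ω)
    (hmk : ∀ t : ℝ, 0 < t → IsMarkovKernel (κ t))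
    (hsg : ∀ s t : ℝ, 0 < s → 0 < t → ∀ g : Ω → ℝ, Measurable g →
      (∃ C : ℝ, ∀ x, |g x| ≤ C) → Tker κ (s + t) g = Tker κ t (Tker κ s g))
    (f : Ω → ℝ) (hf : Measurable f) (hfb : ∃ C : ℝ, ∀ x, |f x| ≤ C) :
    (∀ s t : ℝ, 0 < s → 0 < t → ∀ x : Ω,
        0 ≤ Tker κ t (fun y => (Tker κ s f y) ^ 2) x - (Tker κ (t + s) f x) ^ 2 ∧
        Tker κ t (fun y => (Tker κ s f y) ^ 2) x - (Tker κ (t + s) f x) ^ 2 ≤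
          Tker κ (t + s) (fun y => f y ^ 2) x - (Tker κ (t + s) f x) ^ 2) ∧
      (∀ s : ℝ, 0 < s → bmoC κ (Tker κ s f) ≤ bmoC κ f) := by
  obtain ⟨C, hC⟩ := hfb
  have key (s t : ℝ) (hs : 0 < s) (ht : 0 < t) (x : Ω) :
      0 ≤ Tker κ t (fun y => (Tker κ s f y) ^ 2) x - (Tker κ (t + s) f x) ^ 2 ∧
      Tker κ t (fun y => (Tker κ s f y) ^ 2) x - (Tker κ (t + s) f x) ^ 2 ≤
        Tker κ (t + s) (fun y => f y ^ 2) x - (Tker κ (t + s) f x) ^ 2 := by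
    have := hmk s hs
    have := hmk t ht
    have hC2 := abs_sq_le_of_abs_le hC
    have hTC := abs_Tker_le (κ := κ) (t := s) hC
    have hTf := measurable_Tker (κ := κ) (t := s) hf
    rw [add_comm t s, hsg s t hs ht f hf ⟨C, hC⟩, hsg s t hs ht _ (hf.pow_const 2) ⟨_, hC2⟩]
    exact ⟨sub_nonneg.2 (sq_Tker_le hTf hTC x),
      sub_le_sub_right (Tker_mono (hTf.pow_const 2) (measurable_Tker (hf.pow_const 2))
        (abs_sq_le_of_abs_le hTC) (abs_Tker_le hC2) (sq_Tker_le hf hC) x) _⟩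
  refine ⟨key, fun s hs => ?_⟩
  have hnonneg : 0 ≤ bmoC κ f :=
    Real.iSup_nonneg fun _ => Real.iSup_nonneg fun _ => Real.sqrt_nonneg _
  refine Real.iSup_le (fun ⟨t, ht⟩ => Real.iSup_le (fun x => ?_) hnonneg) hnonneg
  refine le_trans (Real.sqrt_le_sqrt ?_) (le_bmoC hmk hC (add_pos ht hs) x)
  have h := (key s t hs ht x).2
  rwa [show Tker κ t (Tker κ s f) = Tker κ (t + s) f by
    rw [add_comm, hsg s t hs ht f hf ⟨C, hC⟩]]
end
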